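/- Let m,n,p ≥ 3 and let D be the DFA over alphabet {a,b} with state set {0,…,m−1}×{0,…,n−1}×{0,…,p−1}, where letter a sends (i,j,k) to (i+1 mod m, j+1 mod n, k) and letter b sends (i,j,k) to (i, τ(j), k+1 mod p), τ being the transposition exchanging 0 and 1 and fixing all other elements of {0,…,n−1}. For boolean connectives ⊙₁, ⊙₂ each chosen among disjunction, conjunction and exclusive-or, declare a state (i,j,k) final when ((i = m−1) ⊙₁ (j = n−1)) ⊙₂ (k = p−1) holds. Then for every such choice of ⊙₁ and ⊙₂, any two distinct states of D are distinguishable: there is a word w such that exactly one of the two states reaches a final state after reading w. -/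

import Mathlib

/-- The cyclic permutation `i ↦ i+1 mod n` on `{0,…,n−1}`. -/
def cyc {n : ℕ} (i : Fin n) : Fin n := ⟨(i.val + 1) % n, Nat.mod_lt _ i.pos⟩

/-- The transposition exchanging `0` and `1` and fixing all other elements of `{0,…,n−1}`. -/
def transp {n : ℕ} (i : Fin n) : Fin n :=
  if i.val = 0 then ⟨1 % n, Nat.mod_lt _ i.pos⟩
  else if i.val = 1 then ⟨0, i.pos⟩ else i

/-- The contraction sending `1` to `0` and fixing all other elements of `{0,…,n−1}`. -/
def contr {n : ℕ} (i : Fin n) : Fin n := if i.val = 1 then ⟨0, i.pos⟩ else i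

/-- A Brzozowski-type complete DFA: state set `{0,…,n−1}`, initial state `0`,
unique final state `n−1`, where each letter `x` acts as the transformation `f x`. -/
def brzDFA {α : Type} (n : ℕ) (hn : 0 < n) (f : α → Fin n → Fin n) : DFA α (Fin n) where
  step q x := f x q
  start := ⟨0, hn⟩
  accept := {⟨n - 1, Nat.sub_lt hn Nat.one_pos⟩}

/-- The two-letter alphabet `{a,b}`. -/
inductive Two | a | b

/-- The transition function of the product DFA `D` of `X_m(a,−,−;{b})`,
`X_n(a,b,−;∅)` and `X_p(b,−,−;{a}})`. -/
def Dstep (m n p : ℕ) : (Fin m × Fin n × Fin p) → Two → (Fin m × Fin n × Fin p)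
  | (i, j, k), Two.a => (cyc i, cyc j, k)
  | (i, j, k), Two.b => (i, transp j, cyc k)

/-- The final-state predicate `((i = m−1) ⊙₁ (j = n−1)) ⊙₂ (k = p−1)`. -/
def Dfinal (m n p : ℕ) (o₁ o₂ : Prop → Prop → Prop) (q : Fin m × Fin n × Fin p) : Prop :=
  o₂ (o₁ (q.1.val = m - 1) (q.2.1.val = n - 1)) (q.2.2.val = p - 1)

/-- The action of a word on the first coordinate. -/
def stepI {m : ℕ} : Fin m → Two → Fin m
  | i, Two.a => cyc i
  | i, Two.b => i

/-- The action of a word on the second coordinate. -/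
def stepJ {n : ℕ} : Fin n → Two → Fin n
  | j, Two.a => cyc j
  | j, Two.b => transp j

/-- The action of a word on the third coordinate. -/
def stepK {p : ℕ} : Fin p → Two → Fin p
  | k, Two.a => k
  | k, Two.b => cyc k

theorem foldl_Dstep {m n p : ℕ} (w : List Two) (i : Fin m) (j : Fin n) (k : Fin p) :
    w.foldl (Dstep m n p) (i, j, k) =
      (w.foldl stepI i, w.foldl stepJ j, w.foldl stepK k) := by
  induction w generalizing i j k with
  | nil => rfl
  | cons x w ih => cases x <;> simp [Dstep, stepI, stepJ, stepK, ih]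

theorem foldl_replicate_eq_iterate {α β : Type*} (f : β → α → β) (x : α) (N : ℕ) (s : β) :
    (List.replicate N x).foldl f s = (fun t => f t x)^[N] s := by
  induction N generalizing s with
  | zero => rfl
  | succ N ih => simp [List.replicate_succ, ih]

theorem foldl_injective {α β : Type*} {f : β → α → β}
    (hf : ∀ x, Function.Injective fun s => f s x) (w : List α) :
    Function.Injective fun s => w.foldl f s := by
  induction w with
  | nil => exact fun _ _ h => h
  | cons x w ih => exact fun _ _ h => hf x (ih h)

theorem cyc_injective {n : ℕ} : Function.Injective (cyc (n := n)) := by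
  intro i j h
  have h' : i.val + 1 ≡ j.val + 1 [MOD n] := congrArg Fin.val h
  exact Fin.ext ((Nat.ModEq.add_right_cancel' 1 h').eq_of_lt_of_lt i.isLt j.isLt)

theorem cyc_iterate_val {n : ℕ} (i : Fin n) (N : ℕ) :
    (cyc^[N] i).val = (i.val + N) % n := by
  induction N with
  | zero => simp [Nat.mod_eq_of_lt i.isLt]
  | succ N ih => simp [Function.iterate_succ_apply', cyc, ih, Nat.add_assoc]

theorem cyc_iterate_eq_self {n N : ℕ} (h : n ∣ N) (i : Fin n) : cyc^[N] i = i := by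
  obtain ⟨c, rfl⟩ := h
  ext
  simp [cyc_iterate_val, Nat.mod_eq_of_lt i.isLt]

theorem transp_involutive {n : ℕ} (hn : 2 ≤ n) : Function.Involutive (transp (n := n)) := by
  intro i
  have h1 : 1 % n = 1 := Nat.mod_eq_of_lt hn
  ext
  simp only [transp, h1]
  split_ifs <;> simp_all

theorem stepJ_injective {n : ℕ} (hn : 2 ≤ n) (x : Two) :
    Function.Injective fun j : Fin n => stepJ j x := by
  cases x
  · exact cyc_injective
  · exact (transp_involutive hn).injective

/-- If a family of injective self-maps of `Fin N`, `3 ≤ N`, can send every element to the last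
one, then it can realize every admissible pattern of hitting the last element for two inputs. -/
theorem exists_pattern {ι : Type*} {N : ℕ} (hN : 3 ≤ N) (f : ι → Fin N → Fin N)
    (hf : ∀ t, Function.Injective (f t)) (htrans : ∀ x, ∃ t, (f t x).val = N - 1)
    (x y : Fin N) (u v : Bool) (huv : if x = y then u = v else (u && v) = false) :
    ∃ t, ((f t x).val = N - 1 ↔ u = true) ∧ ((f t y).val = N - 1 ↔ v = true) := by
  have hlast : ∀ t z z', (f t z).val = N - 1 → z' ≠ z → (f t z').val ≠ N - 1 :=
    fun t z z' h hne h' => hne (hf t (Fin.ext (h'.trans h.symm)))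
  have hnone : u = false → v = false →
      ∃ t, ((f t x).val = N - 1 ↔ u = true) ∧ ((f t y).val = N - 1 ↔ v = true) := by
    rintro rfl rfl
    obtain ⟨z, hzx, hzy⟩ : ∃ z : Fin N, x ≠ z ∧ y ≠ z := by
      have hc : ({x, y} : Finset (Fin N)).card < (Finset.univ : Finset (Fin N)).card :=
        Finset.card_le_two.trans_lt (by rwa [Finset.card_univ, Fintype.card_fin])
      obtain ⟨z, -, hz⟩ := Finset.exists_mem_notMem_of_card_lt_card hc
      simp only [Finset.mem_insert, Finset.mem_singleton, not_or] at hz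
      exact ⟨z, Ne.symm hz.1, Ne.symm hz.2⟩
    obtain ⟨t, ht⟩ := htrans z
    exact ⟨t, by simp [hlast t z x ht hzx], by simp [hlast t z y ht hzy]⟩
  cases u <;> cases v
  · exact hnone rfl rfl
  · obtain ⟨t, ht⟩ := htrans y
    have hxy : x ≠ y := by rintro rfl; simp at huv
    exact ⟨t, by simp [hlast t y x ht hxy], by simp [ht]⟩
  · obtain ⟨t, ht⟩ := htrans x
    have hxy : x ≠ y := by rintro rfl; simp at huv
    exact ⟨t, by simp [ht], by simp [hlast t x y ht hxy.symm]⟩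
  · obtain ⟨t, ht⟩ := htrans x
    have hxy : x = y := by by_contra h; simp [h] at huv
    subst hxy
    exact ⟨t, by simp [ht], by simp [ht]⟩

theorem exists_cyc_iterate_last {N : ℕ} (x : Fin N) : ∃ t, (cyc^[t] x).val = N - 1 := by
  refine ⟨N - 1 - x.val, ?_⟩
  rw [cyc_iterate_val, show x.val + (N - 1 - x.val) = N - 1 by omega]
  exact Nat.mod_eq_of_lt (by have := x.isLt; omega)

theorem foldl_stepI_replicate_a {m : ℕ} (N : ℕ) (i : Fin m) :
    (List.replicate N Two.a).foldl stepI i = cyc^[N] i :=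
  foldl_replicate_eq_iterate _ _ _ _

theorem foldl_stepJ_replicate_a {n : ℕ} (N : ℕ) (j : Fin n) :
    (List.replicate N Two.a).foldl stepJ j = cyc^[N] j :=
  foldl_replicate_eq_iterate _ _ _ _

theorem foldl_stepK_replicate_a {p : ℕ} (N : ℕ) (k : Fin p) :
    (List.replicate N Two.a).foldl stepK k = k :=
  (foldl_replicate_eq_iterate _ _ _ _).trans (Function.iterate_fixed rfl N)

theorem foldl_stepI_replicate_b {m : ℕ} (N : ℕ) (i : Fin m) :
    (List.replicate N Two.b).foldl stepI i = i :=
  (foldl_replicate_eq_iterate _ _ _ _).trans (Function.iterate_fixed rfl N)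

theorem foldl_stepJ_replicate_b {n : ℕ} (N : ℕ) (j : Fin n) :
    (List.replicate N Two.b).foldl stepJ j = transp^[N] j :=
  foldl_replicate_eq_iterate _ _ _ _

theorem foldl_stepK_replicate_b {p : ℕ} (N : ℕ) (k : Fin p) :
    (List.replicate N Two.b).foldl stepK k = cyc^[N] k :=
  foldl_replicate_eq_iterate _ _ _ _

/-- Words acting trivially on the first and third coordinates. -/
def FixIK (m p : ℕ) (w : List Two) : Prop :=
  (∀ i : Fin m, w.foldl stepI i = i) ∧ ∀ k : Fin p, w.foldl stepK k = k

theorem FixIK.append {m p : ℕ} {w w' : List Two} (h : FixIK m p w) (h' : FixIK m p w') :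
    FixIK m p (w ++ w') := by
  constructor <;> intro x <;> simp [h.1, h.2, h'.1, h'.2]

/-- A conjugate by a power of `a` of the commutator of `b` and `a` sends `j` to `j + 1`. -/
theorem exists_fixIK_succ {m n p : ℕ} (hm : 0 < m) (hn : 3 ≤ n) (hp : 0 < p) (j : Fin n)
    (hj : j.val + 1 < n) :
    ∃ w, FixIK m p w ∧ (w.foldl stepJ j).val = j.val + 1 := by
  have hmn : n ≤ m * n := Nat.le_mul_of_pos_left n hm
  refine ⟨List.replicate (n - j.val) Two.a ++ (List.replicate 1 Two.b ++
    (List.replicate 1 Two.a ++ (List.replicate (2 * p - 1) Two.b ++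
    List.replicate (m * n - 1 + (m * n - (n - j.val))) Two.a))), ⟨fun i => ?_, fun k => ?_⟩, ?_⟩
  · simp only [List.foldl_append, foldl_stepI_replicate_a, foldl_stepI_replicate_b,
      ← Function.iterate_add_apply]
    exact cyc_iterate_eq_self ⟨2 * n, by rw [Nat.mul_left_comm]; omega⟩ i
  · simp only [List.foldl_append, foldl_stepK_replicate_a, foldl_stepK_replicate_b,
      ← Function.iterate_add_apply]
    exact cyc_iterate_eq_self ⟨2, by omega⟩ k
  · simp only [List.foldl_append, foldl_stepJ_replicate_a, foldl_stepJ_replicate_b]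
    have h0 : cyc^[n - j.val] j = ⟨0, by omega⟩ := by
      ext
      simp [cyc_iterate_val, show j.val + (n - j.val) = n by omega]
    have h1 : transp^[1] (⟨0, by omega⟩ : Fin n) = ⟨1, by omega⟩ := by
      ext
      simp [transp, Nat.mod_eq_of_lt (show 1 < n by omega)]
    have h2 : cyc^[1] (⟨1, by omega⟩ : Fin n) = ⟨2, by omega⟩ := by
      ext
      simp [cyc, Nat.mod_eq_of_lt (show 2 < n by omega)]
    have h3 : transp^[2 * p - 1] (⟨2, by omega⟩ : Fin n) = ⟨2, by omega⟩ :=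
      Function.iterate_fixed (by simp [transp]) _
    rw [h0, h1, h2, h3, cyc_iterate_val]
    have h4 : 2 + (m * n - 1 + (m * n - (n - j.val))) = (j.val + 1) + n * (2 * m - 1) := by
      have : n * (2 * m - 1) = 2 * (m * n) - n := by
        rw [Nat.mul_sub, Nat.mul_one, Nat.mul_left_comm, Nat.mul_comm n m]
      omega
    simp only [h4, Nat.add_mul_mod_self_left]
    exact Nat.mod_eq_of_lt hj

theorem exists_fixIK_last {m n p : ℕ} (hm : 0 < m) (hn : 3 ≤ n) (hp : 0 < p) (j : Fin n) :
    ∃ w, FixIK m p w ∧ (w.foldl stepJ j).val = n - 1 := by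
  induction hd : n - 1 - j.val generalizing j with
  | zero => exact ⟨[], ⟨fun _ => rfl, fun _ => rfl⟩, by simp only [List.foldl_nil]; omega⟩
  | succ d ih =>
    obtain ⟨w, hw, hwj⟩ := exists_fixIK_succ hm hn hp j (by omega)
    obtain ⟨w', hw', hwj'⟩ := ih (w.foldl stepJ j) (by omega)
    exact ⟨w ++ w', hw.append hw', by rwa [List.foldl_append]⟩

/-- Suitable truth values separate two inputs of `(x ⊙₁ y) ⊙₂ z`: coordinates known to be equal
get equal values, coordinates known to differ are not both true. -/
theorem exists_separating_values {o₁ o₂ : Prop → Prop → Prop}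
    (ho₁ : o₁ = Or ∨ o₁ = And ∨ o₁ = Xor) (ho₂ : o₂ = Or ∨ o₂ = And ∨ o₂ = Xor)
    (P Q R : Prop) [Decidable P] [Decidable Q] [Decidable R] (h : ¬(P ∧ Q ∧ R)) :
    ∃ x x' y y' z z' : Bool,
      (if P then x = x' else (x && x') = false) ∧ (if Q then y = y' else (y && y') = false) ∧
      (if R then z = z' else (z && z') = false) ∧
      Xor (o₂ (o₁ (x = true) (y = true)) (z = true))
        (o₂ (o₁ (x' = true) (y' = true)) (z' = true)) := by
  by_cases hP : P <;> by_cases hQ : Q <;> by_cases hR : R <;>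
    simp only [hP, hQ, hR, and_self, and_true, and_false, not_true_eq_false, if_true,
      if_false] at h ⊢ <;>
    rcases ho₁ with rfl | rfl | rfl <;> rcases ho₂ with rfl | rfl | rfl <;> decide

theorem statement3 (m n p : ℕ) (hm : 3 ≤ m) (hn : 3 ≤ n) (hp : 3 ≤ p)
    (o₁ o₂ : Prop → Prop → Prop)
    (ho₁ : o₁ = Or ∨ o₁ = And ∨ o₁ = Xor')
    (ho₂ : o₂ = Or ∨ o₂ = And ∨ o₂ = Xor')
    (s s' : Fin m × Fin n × Fin p) (hss' : s ≠ s') :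
    ∃ w : List Two,
      Xor' (Dfinal m n p o₁ o₂ (w.foldl (Dstep m n p) s))
        (Dfinal m n p o₁ o₂ (w.foldl (Dstep m n p) s')) := by
  obtain ⟨i, j, k⟩ := s
  obtain ⟨i', j', k'⟩ := s'
  obtain ⟨x, x', y, y', z, z', hx, hy, hz, hsep⟩ :=
    exists_separating_values ho₁ ho₂ (i = i') (j = j') (k = k')
      (fun h => hss' (by rw [h.1, h.2.1, h.2.2]))
  obtain ⟨e, hi, hi'⟩ := exists_pattern hm (fun e => cyc^[e])
    (fun e => cyc_injective.iterate e) exists_cyc_iterate_last i i' x x' hx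
  obtain ⟨f, hk, hk'⟩ := exists_pattern hp (fun e => cyc^[e])
    (fun e => cyc_injective.iterate e) exists_cyc_iterate_last k k' z z' hz
  have hinj := foldl_injective (stepJ_injective (n := n) (by omega))
  let v := List.replicate e Two.a ++ List.replicate f Two.b
  obtain ⟨⟨w, hw⟩, hj, hj'⟩ := exists_pattern hn
    (fun (w : {w // FixIK m p w}) j => w.1.foldl stepJ j) (fun w => hinj w.1)
    (fun j => by
      obtain ⟨w, hw, hwj⟩ := exists_fixIK_last (m := m) (p := p) (by omega) hn (by omega) j
      exact ⟨⟨w, hw⟩, hwj⟩)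
    (v.foldl stepJ j) (v.foldl stepJ j') y y' (by simpa only [(hinj v).eq_iff] using hy)
  have hI : ∀ i : Fin m, (v ++ w).foldl stepI i = cyc^[e] i := fun i => by
    simp [v, foldl_stepI_replicate_a, foldl_stepI_replicate_b, hw.1]
  have hK : ∀ k : Fin p, (v ++ w).foldl stepK k = cyc^[f] k := fun k => by
    simp [v, foldl_stepK_replicate_a, foldl_stepK_replicate_b, hw.2]
  refine ⟨v ++ w, ?_⟩
  simp only [foldl_Dstep, hI, hK, Dfinal]
  simp only [List.foldl_append, hi, hi', hj, hj', hk, hk']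
  exact hsep
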